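/- Let f, g be linearly independent homogeneous polynomials of degree d in ℂ[x,y,z], spanning a pencil P. If every nonzero member of P is semistable, then P is semistable; if every nonzero member of P is stable, then P is stable. -/

import Mathlib

/-- The coefficient `f_{ij}` of the monomial `x^i y^j z^(d-i-j)` in a polynomial
`f ∈ ℂ[x,y,z]`, regarded as a plane curve of degree `d`. -/
noncomputable def coeffIJ (d : ℕ) (f : MvPolynomial (Fin 3) ℂ) (i j : ℕ) : ℂ :=
  MvPolynomial.coeff
    (Finsupp.single (0 : Fin 3) i + Finsupp.single (1 : Fin 3) j +
      Finsupp.single (2 : Fin 3) (d - i - j)) f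

/-- A normalized weight triple `(ax, ay, az)`:
`ax ≥ ay ≥ az`, `ax > 0` and `ax + ay + az = 0`. -/
def NormTriple (ax ay az : ℤ) : Prop :=
  ay ≤ ax ∧ az ≤ ay ∧ 0 < ax ∧ ax + ay + az = 0

/-- The affine weight `ω(f) = min {(ax-az)·i + (ay-az)·j : f_{ij} ≠ 0}` of a plane
curve of degree `d` at a normalized weight triple. -/
noncomputable def curveWeight (ax ay az : ℤ) (d : ℕ) (f : MvPolynomial (Fin 3) ℂ) : ℤ :=
  sInf {w : ℤ | ∃ i j : ℕ, coeffIJ d f i j ≠ 0 ∧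
    w = (ax - az) * (i : ℤ) + (ay - az) * (j : ℤ)}

/-- The Plücker coordinate (2×2 minor) `m_{ijkl} = f_{ij} g_{kl} - g_{ij} f_{kl}`
of the pencil spanned by `f` and `g`. -/
noncomputable def minor (d : ℕ) (f g : MvPolynomial (Fin 3) ℂ) (i j k l : ℕ) : ℂ :=
  coeffIJ d f i j * coeffIJ d g k l - coeffIJ d g i j * coeffIJ d f k l

/-- The affine weight `ω(P) = min {(ax-az)(i+k) + (ay-az)(j+l) : m_{ijkl} ≠ 0}` of the
pencil spanned by `f` and `g` at a normalized weight triple. -/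
noncomputable def pencilWeight (ax ay az : ℤ) (d : ℕ) (f g : MvPolynomial (Fin 3) ℂ) : ℤ :=
  sInf {w : ℤ | ∃ i j k l : ℕ, minor d f g i j k l ≠ 0 ∧
    w = (ax - az) * ((i : ℤ) + (k : ℤ)) + (ay - az) * ((j : ℤ) + (l : ℤ))}

/-- The action of `A ∈ SL(3,ℂ)` on polynomials by the linear substitution
`(x,y,z) ↦ A·(x,y,z)`. -/
noncomputable def actSL (A : Matrix.SpecialLinearGroup (Fin 3) ℂ)
    (f : MvPolynomial (Fin 3) ℂ) : MvPolynomial (Fin 3) ℂ :=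
  MvPolynomial.aeval
    (fun i => ∑ j : Fin 3,
      MvPolynomial.C ((A : Matrix (Fin 3) (Fin 3) ℂ) i j) * MvPolynomial.X j) f

/-- A degree-`d` plane curve `f` is semistable if `ω(f∘A) ≤ (d/3)·s` for every
`A ∈ SL(3,ℂ)` and every normalized weight triple, where `s = (ax-az)+(ay-az)`. -/
def CurveSemistable (d : ℕ) (f : MvPolynomial (Fin 3) ℂ) : Prop :=
  ∀ A : Matrix.SpecialLinearGroup (Fin 3) ℂ, ∀ ax ay az : ℤ, NormTriple ax ay az →
    (curveWeight ax ay az d (actSL A f) : ℚ) ≤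
      (d : ℚ) / 3 * (((ax - az) + (ay - az) : ℤ) : ℚ)

/-- A degree-`d` plane curve `f` is stable if `ω(f∘A) < (d/3)·s` for every
`A ∈ SL(3,ℂ)` and every normalized weight triple. -/
def CurveStable (d : ℕ) (f : MvPolynomial (Fin 3) ℂ) : Prop :=
  ∀ A : Matrix.SpecialLinearGroup (Fin 3) ℂ, ∀ ax ay az : ℤ, NormTriple ax ay az →
    (curveWeight ax ay az d (actSL A f) : ℚ) <
      (d : ℚ) / 3 * (((ax - az) + (ay - az) : ℤ) : ℚ)

/-- The pencil spanned by `f` and `g` is semistable if `ω(P∘A) ≤ (2d/3)·s` for every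
`A ∈ SL(3,ℂ)` and every normalized weight triple. -/
def PencilSemistable (d : ℕ) (f g : MvPolynomial (Fin 3) ℂ) : Prop :=
  ∀ A : Matrix.SpecialLinearGroup (Fin 3) ℂ, ∀ ax ay az : ℤ, NormTriple ax ay az →
    (pencilWeight ax ay az d (actSL A f) (actSL A g) : ℚ) ≤
      (2 * d : ℚ) / 3 * (((ax - az) + (ay - az) : ℤ) : ℚ)

/-- The pencil spanned by `f` and `g` is stable if `ω(P∘A) < (2d/3)·s` for every
`A ∈ SL(3,ℂ)` and every normalized weight triple. -/
def PencilStable (d : ℕ) (f g : MvPolynomial (Fin 3) ℂ) : Prop :=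
  ∀ A : Matrix.SpecialLinearGroup (Fin 3) ℂ, ∀ ax ay az : ℤ, NormTriple ax ay az →
    (pencilWeight ax ay az d (actSL A f) (actSL A g) : ℚ) <
      (2 * d : ℚ) / 3 * (((ax - az) + (ay - az) : ℤ) : ℚ)

/-- The linear substitution by `A` as an algebra homomorphism. -/
noncomputable def actHom (A : Matrix.SpecialLinearGroup (Fin 3) ℂ) :
    MvPolynomial (Fin 3) ℂ →ₐ[ℂ] MvPolynomial (Fin 3) ℂ :=
  MvPolynomial.aeval
    (fun i => ∑ j : Fin 3,
      MvPolynomial.C ((A : Matrix (Fin 3) (Fin 3) ℂ) i j) * MvPolynomial.X j)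

theorem actHom_apply (A : Matrix.SpecialLinearGroup (Fin 3) ℂ) (f : MvPolynomial (Fin 3) ℂ) :
    actHom A f = actSL A f := rfl

theorem actHom_inv_comp (A : Matrix.SpecialLinearGroup (Fin 3) ℂ) :
    (actHom A⁻¹).comp (actHom A) = AlgHom.id ℂ _ := by
  refine MvPolynomial.algHom_ext fun i => ?_
  have hA : (A : Matrix (Fin 3) (Fin 3) ℂ) * (A⁻¹ : Matrix.SpecialLinearGroup (Fin 3) ℂ) = 1 := by
    rw [← Matrix.SpecialLinearGroup.coe_mul, mul_inv_cancel, Matrix.SpecialLinearGroup.coe_one]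
  have hentry : ∀ k : Fin 3, ∑ j : Fin 3, (A : Matrix (Fin 3) (Fin 3) ℂ) i j *
      ((A⁻¹ : Matrix.SpecialLinearGroup (Fin 3) ℂ) : Matrix (Fin 3) (Fin 3) ℂ) j k =
      if i = k then 1 else 0 := fun k => by
    rw [← Matrix.mul_apply, hA, Matrix.one_apply]
  have hX : ∀ (B : Matrix.SpecialLinearGroup (Fin 3) ℂ) (j : Fin 3),
      actHom B (MvPolynomial.X j) = ∑ k : Fin 3,
        MvPolynomial.C ((B : Matrix (Fin 3) (Fin 3) ℂ) j k) * MvPolynomial.X k :=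
    fun B j => MvPolynomial.aeval_X _ j
  have hC : ∀ (B : Matrix.SpecialLinearGroup (Fin 3) ℂ) (c : ℂ),
      actHom B (MvPolynomial.C c) = MvPolynomial.C c :=
    fun B c => MvPolynomial.aeval_C _ c
  rw [AlgHom.comp_apply, hX, map_sum]
  simp only [map_mul, hX, hC, Finset.mul_sum, ← mul_assoc]
  rw [Finset.sum_comm]
  simp only [← Finset.sum_mul, ← MvPolynomial.C_mul, ← map_sum, hentry]
  simp

theorem actSL_injective (A : Matrix.SpecialLinearGroup (Fin 3) ℂ) :
    Function.Injective (actSL A) :=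
  Function.LeftInverse.injective (g := actSL A⁻¹) fun f =>
    DFunLike.congr_fun (actHom_inv_comp A) f

theorem actSL_ne_zero (A : Matrix.SpecialLinearGroup (Fin 3) ℂ)
    {f : MvPolynomial (Fin 3) ℂ} (hf : f ≠ 0) : actSL A f ≠ 0 := fun h =>
  hf (actSL_injective A (h.trans (map_zero (actHom A)).symm))

theorem actSL_isHomogeneous (A : Matrix.SpecialLinearGroup (Fin 3) ℂ) {d : ℕ}
    {f : MvPolynomial (Fin 3) ℂ} (hf : f.IsHomogeneous d) : (actSL A f).IsHomogeneous d := by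
  have h := hf.aeval (fun i => ∑ j : Fin 3,
      MvPolynomial.C ((A : Matrix (Fin 3) (Fin 3) ℂ) i j) * MvPolynomial.X j) (n := 1)
    fun i => MvPolynomial.IsHomogeneous.sum _ _ _ fun j _ =>
      MvPolynomial.isHomogeneous_C_mul_X _ _
  rwa [one_mul] at h

theorem exists_coeffIJ_ne_zero {d : ℕ} {f : MvPolynomial (Fin 3) ℂ}
    (hf : f.IsHomogeneous d) (h0 : f ≠ 0) : ∃ i j : ℕ, coeffIJ d f i j ≠ 0 := by
  obtain ⟨m, hm⟩ := MvPolynomial.ne_zero_iff.mp h0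
  have hdeg : m 0 + m 1 + m 2 = d := by
    have h := hf hm
    rw [Finsupp.weight_apply, Finsupp.sum_fintype _ _ (by simp), Fin.sum_univ_three] at h
    simpa using h
  refine ⟨m 0, m 1, ?_⟩
  have : Finsupp.single (0 : Fin 3) (m 0) + Finsupp.single (1 : Fin 3) (m 1) +
      Finsupp.single (2 : Fin 3) (d - m 0 - m 1) = m := by
    ext k
    fin_cases k <;> simp <;> omega
  rwa [coeffIJ, this]

/-- The affine weight of a nonzero curve is attained by one of its monomials. -/
theorem exists_curveWeight_eq {ax ay az : ℤ} (hn : NormTriple ax ay az) {d : ℕ}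
    {f : MvPolynomial (Fin 3) ℂ} (hf : f.IsHomogeneous d) (h0 : f ≠ 0) :
    ∃ i j : ℕ, coeffIJ d f i j ≠ 0 ∧
      curveWeight ax ay az d f = (ax - az) * (i : ℤ) + (ay - az) * (j : ℤ) := by
  obtain ⟨i, j, hij⟩ := exists_coeffIJ_ne_zero hf h0
  obtain ⟨h1, h2, -, -⟩ := hn
  refine Int.csInf_mem (s := {w : ℤ | ∃ i j : ℕ, coeffIJ d f i j ≠ 0 ∧
    w = (ax - az) * (i : ℤ) + (ay - az) * (j : ℤ)}) ⟨_, i, j, hij, rfl⟩ ⟨0, ?_⟩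
  rintro w ⟨k, l, -, rfl⟩
  have hx : 0 ≤ ax - az := by omega
  have hy : 0 ≤ ay - az := by omega
  positivity

theorem pencilWeight_le {ax ay az : ℤ} (hn : NormTriple ax ay az) {d : ℕ}
    {f g : MvPolynomial (Fin 3) ℂ} {i j k l : ℕ} (h : minor d f g i j k l ≠ 0) :
    pencilWeight ax ay az d f g ≤
      (ax - az) * ((i : ℤ) + (k : ℤ)) + (ay - az) * ((j : ℤ) + (l : ℤ)) := by
  obtain ⟨h1, h2, -, -⟩ := hn
  refine csInf_le ⟨0, ?_⟩ ⟨i, j, k, l, h, rfl⟩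
  rintro w ⟨i, j, k, l, -, rfl⟩
  have hx : 0 ≤ ax - az := by omega
  have hy : 0 ≤ ay - az := by omega
  positivity

/-- The affine weight of a pencil is at most the sum of the affine weights of two of its
nonzero members, the second one obtained by cancelling in `g` a monomial of least weight
of `f`. -/
theorem exists_pencilWeight_le_add {ax ay az : ℤ} (hn : NormTriple ax ay az) {d : ℕ}
    {f g : MvPolynomial (Fin 3) ℂ} (hf : f.IsHomogeneous d) (hg : g.IsHomogeneous d)
    (hind : LinearIndependent ℂ ![f, g]) (A : Matrix.SpecialLinearGroup (Fin 3) ℂ) :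
    ∃ h₁ ∈ Submodule.span ℂ ({f, g} : Set (MvPolynomial (Fin 3) ℂ)),
      ∃ h₂ ∈ Submodule.span ℂ ({f, g} : Set (MvPolynomial (Fin 3) ℂ)), h₁ ≠ 0 ∧ h₂ ≠ 0 ∧
        pencilWeight ax ay az d (actSL A f) (actSL A g) ≤
          curveWeight ax ay az d (actSL A h₁) + curveWeight ax ay az d (actSL A h₂) := by
  have hf0 : f ≠ 0 := hind.ne_zero 0
  obtain ⟨i, j, hij, hw₁⟩ :=
    exists_curveWeight_eq hn (actSL_isHomogeneous A hf) (actSL_ne_zero A hf0)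
  set c := coeffIJ d (actSL A f) i j with hc
  set e := coeffIJ d (actSL A g) i j with he
  have hh0 : (-e) • f + c • g ≠ 0 := fun h =>
    hij (LinearIndependent.pair_iff.mp hind _ _ h).2
  have hhom : ((-e) • f + c • g).IsHomogeneous d :=
    (MvPolynomial.homogeneousSubmodule (Fin 3) ℂ d).add_mem
      (Submodule.smul_mem _ _ hf) (Submodule.smul_mem _ _ hg)
  obtain ⟨k, l, hkl, hw₂⟩ :=
    exists_curveWeight_eq hn (actSL_isHomogeneous A hhom) (actSL_ne_zero A hh0)
  have hmem₁ : f ∈ Submodule.span ℂ ({f, g} : Set (MvPolynomial (Fin 3) ℂ)) :=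
    Submodule.subset_span (by simp)
  have hmem₂ : g ∈ Submodule.span ℂ ({f, g} : Set (MvPolynomial (Fin 3) ℂ)) :=
    Submodule.subset_span (by simp)
  refine ⟨f, hmem₁, (-e) • f + c • g,
    Submodule.add_mem _ (Submodule.smul_mem _ _ hmem₁) (Submodule.smul_mem _ _ hmem₂),
    hf0, hh0, ?_⟩
  have hminor : minor d (actSL A f) (actSL A g) i j k l ≠ 0 := by
    convert hkl using 1
    rw [← actHom_apply A ((-e) • f + c • g), map_add, map_smul, map_smul, actHom_apply,
      actHom_apply]
    simp only [minor, coeffIJ, MvPolynomial.coeff_add, MvPolynomial.coeff_smul, smul_eq_mul, hc, he]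
    ring
  calc _ ≤ _ := pencilWeight_le hn hminor
    _ = _ := by rw [hw₁, hw₂]; ring

/-- If every nonzero member of the pencil spanned by `f` and `g`
is semistable (resp. stable), then the pencil is semistable (resp. stable). -/
theorem pencil_semistable_stable_of_members
    (d : ℕ) (hd : 1 ≤ d) (f g : MvPolynomial (Fin 3) ℂ)
    (hf : f.IsHomogeneous d) (hg : g.IsHomogeneous d)
    (hind : LinearIndependent ℂ ![f, g]) :
    ((∀ h ∈ Submodule.span ℂ ({f, g} : Set (MvPolynomial (Fin 3) ℂ)), h ≠ 0 →
        CurveSemistable d h) → PencilSemistable d f g) ∧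
    ((∀ h ∈ Submodule.span ℂ ({f, g} : Set (MvPolynomial (Fin 3) ℂ)), h ≠ 0 →
        CurveStable d h) → PencilStable d f g) := by
  constructor
  all_goals
    intro H A ax ay az hn
    obtain ⟨h₁, hm₁, h₂, hm₂, hne₁, hne₂, hle⟩ := exists_pencilWeight_le_add hn hf hg hind A
    have b₁ := H h₁ hm₁ hne₁ A ax ay az hn
    have b₂ := H h₂ hm₂ hne₂ A ax ay az hn
    have hle' : (pencilWeight ax ay az d (actSL A f) (actSL A g) : ℚ) ≤
        curveWeight ax ay az d (actSL A h₁) + curveWeight ax ay az d (actSL A h₂) := by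
      exact_mod_cast hle
    linarith
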